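/- arXiv:math/0402157 — 7 statements merged into one kernel-verified Lean document; each statement's English description precedes it below -/
import Mathlib

section
/- The sextonion algebra S is a unital ℂ-algebra with unit (I,0) which is alternative, i.e. x·(x·y) = (x·x)·y and (y·x)·x = y·(x·x) for all x,y ∈ S, but is not associative, and it has zero divisors: there exist nonzero x,y ∈ S with x·y = 0. -/
open Matrix

noncomputable section

/-- 2×2 complex matrices. -/
abbrev M2 : Type := Matrix (Fin 2) (Fin 2) ℂ
/-- ℂ². -/
abbrev V2 : Type := Fin 2 → ℂ
/-- The dual space (ℂ²)*. -/
abbrev Dual2 : Type := Module.Dual ℂ V2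

/-- `X⁰ = (tr X)·I − X`. -/
def msharp (X : M2) : M2 := X.trace • (1 : M2) - X

/-- The underlying vector space of the sextonion algebra: M₂(ℂ) × ℂ². -/
abbrev Sx : Type := M2 × V2

/-- Sextonion multiplication: (X,u)·(Y,v) = (XY, X⁰v + Yu). -/
def mulS (p q : Sx) : Sx := (p.1 * q.1, msharp p.1 *ᵥ q.2 + q.1 *ᵥ p.2)

/-- The sextonion norm q(X,u) = det X. -/
def qS (p : Sx) : ℂ := p.1.det

/-- The polar form of the sextonion norm. -/
def bS (p q : Sx) : ℂ := qS (p + q) - qS p - qS q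

lemma msharp_eq (X : M2) : msharp X = !![X 1 1, -X 0 1; -X 1 0, X 0 0] := by
  ext i j
  fin_cases i <;> fin_cases j <;> simp [msharp, Matrix.trace_fin_two]

lemma mulS_add_left (x y z : Sx) : mulS (x + y) z = mulS x z + mulS y z := by
  have h : msharp (x.1 + y.1) = msharp x.1 + msharp y.1 := by
    simp only [msharp, trace_add, add_smul]
    abel
  ext1
  · simp [mulS, add_mul]
  · simp only [mulS, Prod.fst_add, Prod.snd_add, h, add_mulVec, mulVec_add]
    abel

lemma mulS_add_right (x y z : Sx) : mulS x (y + z) = mulS x y + mulS x z := by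
  ext1
  · simp [mulS, mul_add]
  · simp only [mulS, Prod.fst_add, Prod.snd_add, add_mulVec, mulVec_add]
    abel

lemma mulS_smul_left (c : ℂ) (x y : Sx) : mulS (c • x) y = c • mulS x y := by
  have h : msharp (c • x.1) = c • msharp x.1 := by
    simp [msharp, smul_sub, smul_smul]
  ext1
  · simp [mulS]
  · simp only [mulS, Prod.smul_fst, Prod.smul_snd, h, smul_mulVec, mulVec_smul, smul_add]

lemma mulS_smul_right (c : ℂ) (x y : Sx) : mulS x (c • y) = c • mulS x y := by
  ext1
  · simp [mulS]
  · simp only [mulS, Prod.smul_fst, Prod.smul_snd, smul_mulVec, mulVec_smul, smul_add]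

lemma msharp_one : msharp 1 = 1 := by
  rw [msharp_eq]
  simp [Matrix.one_fin_two]

lemma one_mulS (x : Sx) : mulS ((1 : M2), (0 : V2)) x = x := by
  simp [mulS, msharp_one]

lemma mulS_one (x : Sx) : mulS x ((1 : M2), (0 : V2)) = x := by
  simp [mulS]

lemma msharp_mul (X Y : M2) : msharp (X * Y) = msharp Y * msharp X := by
  simp only [msharp_eq]
  ext i j
  fin_cases i <;> fin_cases j <;> simp [Matrix.mul_apply, Fin.sum_univ_two] <;> ring

lemma msharp_add_self (X : M2) : msharp X + X = X.trace • (1 : M2) := by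
  simp [msharp]

lemma mulS_left_alternative (x y : Sx) : mulS x (mulS x y) = mulS (mulS x x) y := by
  obtain ⟨X, u⟩ := x
  obtain ⟨Y, v⟩ := y
  ext1
  · simp [mulS, mul_assoc]
  · have h : msharp X * Y + X * Y = Y * msharp X + Y * X := by
      rw [← add_mul, ← mul_add, msharp_add_self]
      simp
    simp only [mulS, msharp_mul, mulVec_add, mulVec_mulVec, add_assoc, ← add_mulVec, h, mul_add]

lemma mulS_right_alternative (x y : Sx) : mulS (mulS y x) x = mulS y (mulS x x) := by
  obtain ⟨X, u⟩ := x
  obtain ⟨Y, v⟩ := y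
  ext1
  · simp [mulS, mul_assoc]
  · have h : msharp X * msharp Y + X * msharp Y = msharp Y * msharp X + msharp Y * X := by
      rw [← add_mul, ← mul_add, msharp_add_self]
      simp
    simp only [mulS, msharp_mul, mulVec_add, mulVec_mulVec, ← add_assoc, ← add_mulVec, h, mul_add]

lemma mulS_not_assoc : ¬ ∀ x y z : Sx, mulS (mulS x y) z = mulS x (mulS y z) := by
  intro h
  have h₀ := congrFun (congrArg Prod.snd
    (h (!![0, 1; 0, 0], 0) (!![0, 0; 1, 0], 0) (0, ![1, 0]))) 0
  simp [mulS, msharp_eq, dotProduct, Fin.sum_univ_two] at h₀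

lemma exists_mulS_eq_zero : ∃ x y : Sx, x ≠ 0 ∧ y ≠ 0 ∧ mulS x y = 0 := by
  have h : ((0 : M2), (![1, 0] : V2)) ≠ 0 := by
    simp [Prod.ext_iff]
  exact ⟨_, _, h, h, by simp [mulS, msharp]⟩

/-- The sextonion algebra S is a unital ℂ-algebra with unit (I,0) which is
alternative but not associative, and it has zero divisors. -/
theorem sextonions_unital_alternative_not_associative_with_zero_divisors :
    -- the multiplication is ℂ-bilinear, so S is a ℂ-algebra
    (∀ x y z : Sx, mulS (x + y) z = mulS x z + mulS y z) ∧
    (∀ x y z : Sx, mulS x (y + z) = mulS x y + mulS x z) ∧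
    (∀ (c : ℂ) (x y : Sx), mulS (c • x) y = c • mulS x y) ∧
    (∀ (c : ℂ) (x y : Sx), mulS x (c • y) = c • mulS x y) ∧
    -- (I,0) is a two-sided unit
    (∀ x : Sx, mulS ((1 : M2), (0 : V2)) x = x) ∧
    (∀ x : Sx, mulS x ((1 : M2), (0 : V2)) = x) ∧
    -- S is alternative
    (∀ x y : Sx, mulS x (mulS x y) = mulS (mulS x x) y) ∧
    (∀ x y : Sx, mulS (mulS y x) x = mulS y (mulS x x)) ∧
    -- S is not associative
    ¬ (∀ x y z : Sx, mulS (mulS x y) z = mulS x (mulS y z)) ∧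
    -- S has zero divisors
    (∃ x y : Sx, x ≠ 0 ∧ y ≠ 0 ∧ mulS x y = 0) := by
  exact ⟨mulS_add_left, mulS_add_right, mulS_smul_left, mulS_smul_right, one_mulS, mulS_one,
    mulS_left_alternative, mulS_right_alternative, mulS_not_assoc, exists_mulS_eq_zero⟩

end
end

section
/- In the sextonion algebra S, the subspace U := {(0,u) : u ∈ ℂ²} is a two-sided ideal with U·U = 0; the first projection (X,u) ↦ X is a surjective algebra homomorphism S → M₂(ℂ) with kernel U; and U equals the radical of the polar form of the norm, i.e. U = {s ∈ S : b_S(s,t) = 0 for all t ∈ S}. -/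
open Matrix

noncomputable section

/-- The subspace U = {(0,u) : u ∈ ℂ²} of the sextonions. -/
def USet : Set Sx := {s : Sx | s.1 = 0}

/-- The polar form of the norm in coordinates. -/
theorem bS_eq (s t : Sx) :
    bS s t = s.1 0 0 * t.1 1 1 + s.1 1 1 * t.1 0 0 - s.1 0 1 * t.1 1 0 - s.1 1 0 * t.1 0 1 := by
  simp only [bS, qS, Prod.fst_add, Matrix.det_fin_two, Matrix.add_apply]
  ring

/-- U is a two-sided ideal with U·U = 0; the first projection is a surjective
algebra homomorphism S → M₂(ℂ) with kernel U; and U is the radical of the polar form of the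
norm. -/
theorem sextonion_ideal_quotient_radical :
    -- U is a two-sided ideal
    (∀ s t : Sx, s ∈ USet → mulS s t ∈ USet ∧ mulS t s ∈ USet) ∧
    -- U·U = 0
    (∀ s t : Sx, s ∈ USet → t ∈ USet → mulS s t = 0) ∧
    -- the first projection is an algebra homomorphism ...
    (∀ s t : Sx, (mulS s t).1 = s.1 * t.1) ∧
    (∀ s t : Sx, (s + t).1 = s.1 + t.1) ∧
    (∀ (c : ℂ) (s : Sx), (c • s).1 = c • s.1) ∧
    (((1 : M2), (0 : V2)) : Sx).1 = (1 : M2) ∧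
    -- ... which is surjective ...
    Function.Surjective (fun s : Sx => s.1) ∧
    -- ... with kernel U
    (∀ s : Sx, s.1 = 0 ↔ s ∈ USet) ∧
    -- U is the radical of the polar form b_S
    (∀ s : Sx, s ∈ USet ↔ ∀ t : Sx, bS s t = 0) := by
  refine ⟨?_, ?_, fun _ _ => rfl, fun _ _ => rfl, fun _ _ => rfl, rfl, fun X => ⟨(X, 0), rfl⟩,
    fun _ => Iff.rfl, ?_⟩
  · intro s t hs
    have hs : s.1 = 0 := hs
    simp [USet, mulS, hs]
  · intro s t hs ht
    have hs : s.1 = 0 := hs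
    have ht : t.1 = 0 := ht
    simp [mulS, msharp, hs, ht]
  · intro s
    constructor
    · intro hs t
      have hs : s.1 = 0 := hs
      simp [bS, qS, hs]
    · intro h
      change s.1 = 0
      have h' (Y : M2) := bS_eq s (Y, 0) ▸ h (Y, 0)
      ext i j
      fin_cases i <;> fin_cases j
      · simpa using h' !![0, 0; 0, 1]
      · simpa using h' !![0, 0; 1, 0]
      · simpa using h' !![0, 1; 0, 0]
      · simpa using h' !![1, 0; 0, 0]

end
end

section
/- The map ι : S → O, ι(X,u) := (X,u,0), is an injective algebra homomorphism with q_O(ι(X,u)) = det X; the subspace U₊ := {(0,u,0) : u ∈ ℂ²} is a null plane of O; and the image ι(S) = {(X,u,0)} is exactly the orthogonal complement of U₊ with respect to the polar form b. In particular, the sextonions form a six-dimensional subalgebra of the octonions equal to the orthogonal complement of a null plane. -/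
open Matrix

noncomputable section

/-- The rank-one matrix u ⊗ v* : w ↦ v*(w)·u. -/
def rankOne (u : V2) (vs : Dual2) : M2 := vecMulVec u fun j => vs (Pi.single j 1)

/-- The underlying vector space of the octonion model: M₂(ℂ) × ℂ² × (ℂ²)*. -/
abbrev Ox : Type := M2 × V2 × Dual2

/-- Octonion multiplication:
(X,u,u*)·(Y,v,v*) = (XY − 2·u⊗v* − 2·(v⊗u*)⁰, X⁰v + Yu, v*∘X + u*∘Y⁰). -/
def mulO (p q : Ox) : Ox :=
  (p.1 * q.1 - (2 : ℂ) • rankOne p.2.1 q.2.2 - (2 : ℂ) • msharp (rankOne q.2.1 p.2.2),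
   msharp p.1 *ᵥ q.2.1 + q.1 *ᵥ p.2.1,
   q.2.2 ∘ₗ Matrix.mulVecLin p.1 + p.2.2 ∘ₗ Matrix.mulVecLin (msharp q.1))

/-- The octonion norm q(X,u,u*) = det X + 2·u*(u). -/
def qO (p : Ox) : ℂ := p.1.det + 2 * p.2.2 p.2.1

/-- The polar form of the octonion norm. -/
def bO (p q : Ox) : ℂ := qO (p + q) - qO p - qO q

/-- The unit (I,0,0) of the octonion model. -/
def oneO : Ox := (1, 0, 0)

/-- The embedding ι : S → O, (X,u) ↦ (X,u,0). -/
def iota (p : Sx) : Ox := (p.1, p.2, 0)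

/-- The linear embedding u ↦ (0,u,0) of ℂ² into O. -/
def jV : V2 →ₗ[ℂ] Ox :=
  (0 : V2 →ₗ[ℂ] M2).prod ((LinearMap.id : V2 →ₗ[ℂ] V2).prod (0 : V2 →ₗ[ℂ] Dual2))

/-- The plane U₊ = {(0,u,0)} ⊆ O. -/
def Uplus : Submodule ℂ Ox := LinearMap.range jV

/-- The polar form of an octonion with an element of `U₊`. -/
theorem bO_jV (x : Ox) (v : V2) : bO x (jV v) = 2 * x.2.2 v := by
  have hv : jV v = (0, v, 0) := rfl
  simp only [bO, qO, hv, Prod.fst_add, Prod.snd_add, add_zero, map_add, Matrix.det_zero,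
    LinearMap.zero_apply]
  ring

theorem jV_injective : Function.Injective jV := fun u v h => by
  simpa [jV] using h

theorem mulO_jV (u v : V2) : mulO (jV u) (jV v) = 0 := by
  simp [mulO, jV, rankOne, msharp, ← Pi.zero_def]

theorem iota_mulS (s t : Sx) : iota (mulS s t) = mulO (iota s) (iota t) := by
  simp [iota, mulS, mulO, rankOne, msharp, ← Pi.zero_def]

theorem range_iota : Set.range iota = {x : Ox | ∀ y ∈ Uplus, bO x y = 0} := by
  ext x
  constructor
  · rintro ⟨s, rfl⟩ _ ⟨v, rfl⟩
    simp [bO_jV, iota]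
  · intro h
    have hx : x.2.2 = 0 := LinearMap.ext fun v => by
      simpa [bO_jV] using h _ ⟨v, rfl⟩
    exact ⟨(x.1, x.2.1), Prod.ext rfl (Prod.ext rfl hx.symm)⟩

/-- ι : S → O is an injective algebra homomorphism with q_O(ι(X,u)) = det X;
U₊ is a null plane of O; and ι(S) is exactly the b-orthogonal complement of U₊. -/
theorem sextonions_are_orthogonal_complement_of_null_plane :
    -- ι is an algebra homomorphism ...
    (∀ s t : Sx, iota (s + t) = iota s + iota t) ∧
    (∀ (c : ℂ) (s : Sx), iota (c • s) = c • iota s) ∧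
    (∀ s t : Sx, iota (mulS s t) = mulO (iota s) (iota t)) ∧
    iota ((1 : M2), (0 : V2)) = oneO ∧
    -- ... which is injective ...
    Function.Injective iota ∧
    -- ... and compatible with the norms
    (∀ s : Sx, qO (iota s) = qS s) ∧
    -- U₊ is a null plane of O
    Module.finrank ℂ Uplus = 2 ∧
    (∀ x ∈ Uplus, ∀ y ∈ Uplus, mulO x y = 0) ∧
    -- ι(S) = U₊^⊥
    Set.range iota = {x : Ox | ∀ y ∈ Uplus, bO x y = 0} := by
  refine ⟨fun s t => ?_, fun c s => ?_, iota_mulS, rfl, fun s t h => ?_, fun s => ?_, ?_, ?_,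
    range_iota⟩
  · simp [iota]
  · simp [iota]
  · exact Prod.ext (congrArg (fun x : Ox => x.1) h) (congrArg (fun x : Ox => x.2.1) h)
  · simp [iota, qO, qS]
  · rw [Uplus, LinearMap.finrank_range_of_inj jV_injective]
    simp
  · rintro _ ⟨u, rfl⟩ _ ⟨v, rfl⟩
    exact mulO_jV u v

end
end

section
/- Every σ ∈ R satisfies σ(I) = 0 and σ(X²) = tr(X)·σ(X) for all X ∈ M₂(ℂ), and the complex vector space R has dimension 4. -/
open Matrix

noncomputable section

/-- The space R of linear maps σ : M₂(ℂ) → ℂ² with σ(XY) = X⁰σ(Y) + Yσ(X). -/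
def Rsub : Submodule ℂ (M2 →ₗ[ℂ] V2) where
  carrier := {σ | ∀ X Y : M2, σ (X * Y) = msharp X *ᵥ σ Y + Y *ᵥ σ X}
  zero_mem' := by
    intro X Y
    simp [Matrix.mulVec_zero]
  add_mem' := by
    intro σ τ hσ hτ X Y
    simp only [LinearMap.add_apply, hσ X Y, hτ X Y, Matrix.mulVec_add]
    abel
  smul_mem' := by
    intro c σ hσ X Y
    simp only [LinearMap.smul_apply, hσ X Y, Matrix.mulVec_smul, smul_add]

theorem map_one_of_mem_Rsub {σ : M2 →ₗ[ℂ] V2} (hσ : σ ∈ Rsub) : σ 1 = 0 := by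
  have h := hσ 1 1
  have h1 : msharp 1 = 1 := by simp [msharp, Matrix.trace_one, two_smul]
  rw [mul_one, h1, one_mulVec] at h
  simpa using h

theorem map_mul_self_of_mem_Rsub {σ : M2 →ₗ[ℂ] V2} (hσ : σ ∈ Rsub) (X : M2) :
    σ (X * X) = X.trace • σ X := by
  rw [hσ X X, ← add_mulVec, msharp, sub_add_cancel, smul_mulVec, one_mulVec]

/-- The element of `R` with parameters `v`; they are the two coordinates of its value at `E₁₁`, the
second coordinate at `E₁₂` and the first coordinate at `E₂₁`. -/
def mapOfParams (v : Fin 4 → ℂ) : M2 →ₗ[ℂ] V2 where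
  toFun X := ![(X 0 0 - X 1 1) * v 0 + X 0 1 * v 1 + X 1 0 * v 3,
    (X 0 0 - X 1 1) * v 1 + X 0 1 * v 2 - X 1 0 * v 0]
  map_add' X Y := by
    ext i
    fin_cases i <;> simp <;> ring
  map_smul' c X := by
    ext i
    fin_cases i <;> simp <;> ring

theorem mapOfParams_mem_Rsub (v : Fin 4 → ℂ) : mapOfParams v ∈ Rsub := by
  intro X Y
  ext i
  fin_cases i <;>
    simp [mapOfParams, msharp, Matrix.mul_apply, Fin.sum_univ_two,
      Matrix.trace_fin_two] <;> ring

/-- The parameters of a linear map, inverse to `mapOfParams` on `R`. -/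
def params (σ : M2 →ₗ[ℂ] V2) : Fin 4 → ℂ :=
  ![σ (single 0 0 1) 0, σ (single 0 0 1) 1, σ (single 0 1 1) 1, σ (single 1 0 1) 0]

theorem mapOfParams_params {σ : M2 →ₗ[ℂ] V2} (hσ : σ ∈ Rsub) : mapOfParams (params σ) = σ := by
  have h22 : σ (single 1 1 1) = -σ (single 0 0 1) := by
    have h1 : (1 : M2) = single 0 0 1 + single 1 1 1 := by
      ext i j
      fin_cases i <;> fin_cases j <;> simp
    have h := map_one_of_mem_Rsub hσ
    rw [h1, map_add] at h
    exact eq_neg_of_add_eq_zero_right h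
  have h12 := congrFun (hσ (single 0 0 1) (single 0 1 1)) 0
  have h21 := congrFun (hσ (single 0 0 1) (single 1 0 1)) 1
  simp [msharp] at h12 h21
  refine LinearMap.ext fun X => ?_
  have hX : X = X 0 0 • single 0 0 1 + X 0 1 • single 0 1 1 + X 1 0 • single 1 0 1 +
      X 1 1 • single 1 1 1 := by
    ext i j
    fin_cases i <;> fin_cases j <;> simp
  conv_rhs => rw [hX]
  simp only [map_add, map_smul, h22]
  ext i
  fin_cases i
  · simp [mapOfParams, params]
    linear_combination -X 0 1 * h12
  · simp [mapOfParams, params]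
    linear_combination X 1 0 * h21

/-- The space `R` is parametrized linearly by `ℂ⁴`. -/
def paramsEquiv : (Fin 4 → ℂ) ≃ₗ[ℂ] Rsub where
  toFun v := ⟨mapOfParams v, mapOfParams_mem_Rsub v⟩
  invFun σ := params σ
  map_add' v w := by
    ext X i
    fin_cases i <;> simp [mapOfParams] <;> ring
  map_smul' c v := by
    ext X i
    fin_cases i <;> simp [mapOfParams] <;> ring
  left_inv v := by
    ext i
    fin_cases i <;> simp [mapOfParams, params]
  right_inv σ := Subtype.ext (mapOfParams_params σ.2)

/-- every σ ∈ R satisfies σ(I) = 0 and σ(X²) = tr(X)·σ(X), and R has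
complex dimension 4. -/
theorem R_basic_identities_and_dimension :
    (∀ σ : M2 →ₗ[ℂ] V2, σ ∈ Rsub →
      σ (1 : M2) = 0 ∧ ∀ X : M2, σ (X * X) = X.trace • σ X) ∧
    Module.finrank ℂ Rsub = 4 := by
  refine ⟨fun σ hσ => ⟨map_one_of_mem_Rsub hσ, map_mul_self_of_mem_Rsub hσ⟩, ?_⟩
  rw [← paramsEquiv.finrank_eq, Module.finrank_fin_fun]

end
end

section
/- For every m ∈ GL₂(ℂ), the map ρ_m : O → O defined by ρ_m(X,u,u*) := (mXm⁻¹, mu, u*∘m⁻¹) is an algebra automorphism of the octonion model O, and m ↦ ρ_m is an injective group homomorphism from GL₂(ℂ) into the automorphism group of O. -/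
open Matrix

noncomputable section

/-- The map ρ_m : O → O, (X,u,u*) ↦ (mXm⁻¹, mu, u*∘m⁻¹), for m ∈ GL₂(ℂ). -/
def rhoM (m : GL (Fin 2) ℂ) (p : Ox) : Ox :=
  ((m : M2) * p.1 * ((m⁻¹ : GL (Fin 2) ℂ) : M2),
   (m : M2) *ᵥ p.2.1,
   p.2.2 ∘ₗ Matrix.mulVecLin ((m⁻¹ : GL (Fin 2) ℂ) : M2))

theorem msharp_conj (m : GL (Fin 2) ℂ) (X : M2) :
    msharp ((m : M2) * X * ((m⁻¹ : GL (Fin 2) ℂ) : M2)) =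
      (m : M2) * msharp X * ((m⁻¹ : GL (Fin 2) ℂ) : M2) := by
  simp only [msharp, trace_units_conj, mul_sub, sub_mul, mul_smul_comm, smul_mul_assoc, mul_one,
    Units.mul_inv]

theorem rankOne_mulVec (u v : V2) (vs : Dual2) : rankOne u vs *ᵥ v = vs v • u := by
  have hvs : (fun j => vs (Pi.single j 1)) ⬝ᵥ v = vs v := by
    conv_rhs => rw [pi_eq_sum_univ' v, map_sum]
    simp only [dotProduct, map_smul, smul_eq_mul, mul_comm]
  rw [rankOne, vecMulVec_mulVec, hvs, op_smul_eq_smul]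

theorem rankOne_conj (A B : M2) (u : V2) (vs : Dual2) :
    rankOne (A *ᵥ u) (vs ∘ₗ Matrix.mulVecLin B) = A * rankOne u vs * B := by
  refine Matrix.ext_of_mulVec_single fun j => ?_
  simp only [← mulVec_mulVec, rankOne_mulVec, mulVec_smul, LinearMap.comp_apply, mulVecLin_apply]

theorem rhoM_one : rhoM 1 = id := by
  funext p
  simp [rhoM]

theorem rhoM_comp (m m' : GL (Fin 2) ℂ) : rhoM m ∘ rhoM m' = rhoM (m * m') := by
  funext p
  simp only [rhoM, Function.comp_apply, _root_.mul_inv_rev, Units.val_mul, mul_assoc, mulVec_mulVec,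
    LinearMap.comp_assoc, ← mulVecLin_mul]

theorem rhoM_bijective (m : GL (Fin 2) ℂ) : Function.Bijective (rhoM m) := by
  refine Function.bijective_iff_has_inverse.mpr ⟨rhoM m⁻¹, fun p => ?_, fun p => ?_⟩
  · simpa [rhoM_one] using congrFun (rhoM_comp m⁻¹ m) p
  · simpa [rhoM_one] using congrFun (rhoM_comp m m⁻¹) p

theorem rhoM_add (m : GL (Fin 2) ℂ) (p q : Ox) : rhoM m (p + q) = rhoM m p + rhoM m q := by
  simp [rhoM, mul_add, add_mul, mulVec_add, LinearMap.add_comp]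

theorem rhoM_smul (m : GL (Fin 2) ℂ) (c : ℂ) (p : Ox) : rhoM m (c • p) = c • rhoM m p := by
  simp [rhoM, mulVec_smul, LinearMap.smul_comp]

theorem rhoM_mulO (m : GL (Fin 2) ℂ) (p q : Ox) :
    rhoM m (mulO p q) = mulO (rhoM m p) (rhoM m q) := by
  refine Prod.ext ?_ (Prod.ext ?_ ?_)
  · simp only [rhoM, mulO, rankOne_conj, msharp_conj]
    simp only [mul_sub, sub_mul, mul_smul_comm, smul_mul_assoc, mul_assoc,
      Units.inv_mul_cancel_left]
  · simp only [rhoM, mulO, msharp_conj]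
    simp only [mulVec_add, mulVec_mulVec, mul_assoc, Units.inv_mul, mul_one]
  · simp only [rhoM, mulO, msharp_conj]
    simp only [LinearMap.add_comp, LinearMap.comp_assoc, ← mulVecLin_mul, mul_assoc,
      Units.inv_mul_cancel_left]

theorem rhoM_injective : Function.Injective rhoM := by
  intro m m' h
  refine Units.ext (Matrix.ext_of_mulVec_single fun j => ?_)
  exact congrArg (fun p : Ox => p.2.1) (congrFun h (0, Pi.single j 1, 0))

/-- for every m ∈ GL₂(ℂ), ρ_m is an algebra automorphism of O, and m ↦ ρ_m is
an injective group homomorphism GL₂(ℂ) → Aut(O). -/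
theorem rhoM_automorphism_and_injective_group_hom :
    -- each ρ_m is an algebra automorphism of O
    (∀ m : GL (Fin 2) ℂ,
      Function.Bijective (rhoM m) ∧
      (∀ p q : Ox, rhoM m (p + q) = rhoM m p + rhoM m q) ∧
      (∀ (c : ℂ) (p : Ox), rhoM m (c • p) = c • rhoM m p) ∧
      (∀ p q : Ox, rhoM m (mulO p q) = mulO (rhoM m p) (rhoM m q))) ∧
    -- m ↦ ρ_m is a group homomorphism
    (∀ m m' : GL (Fin 2) ℂ, rhoM m ∘ rhoM m' = rhoM (m * m')) ∧
    -- which is injective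
    (∀ m m' : GL (Fin 2) ℂ, rhoM m = rhoM m' → m = m') := by
  exact ⟨fun m => ⟨rhoM_bijective m, rhoM_add m, rhoM_smul m, rhoM_mulO m⟩, rhoM_comp,
    fun _ _ h => rhoM_injective h⟩

end
end

section
/- For every σ ∈ R the following identities hold: (i) w*(σ(u⊗v*)) = v*(σ(u⊗w*)) for all u ∈ ℂ² and v*,w* ∈ (ℂ²)*; (ii) σ†(v*)(u) = −2·σ(u⊗v*) for all u ∈ ℂ² and v* ∈ (ℂ²)*; (iii) σ†(v*∘X⁰) = σ†(v*)·X + 2·σ(X)⊗v* for all X ∈ M₂(ℂ) and v* ∈ (ℂ²)*. -/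
open Matrix

noncomputable section

/-- Membership in R: σ(XY) = X⁰σ(Y) + Yσ(X). -/
def Rcond (σ : M2 →ₗ[ℂ] V2) : Prop :=
  ∀ X Y : M2, σ (X * Y) = msharp X *ᵥ σ Y + Y *ᵥ σ X

theorem dual_apply_fin_two (vs : Dual2) (x : V2) :
    vs x = x 0 * vs (Pi.single 0 1) + x 1 * vs (Pi.single 1 1) := by
  conv_lhs => rw [pi_eq_sum_univ' x]
  simp [Fin.sum_univ_two]

theorem map_eq_sum_single (σ : M2 →ₗ[ℂ] V2) (X : M2) :
    σ X = X 0 0 • σ (single 0 0 1) + X 0 1 • σ (single 0 1 1) +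
      X 1 0 • σ (single 1 0 1) + X 1 1 • σ (single 1 1 1) := by
  simp only [← map_smul, ← map_add]
  congr 1
  ext i j
  fin_cases i <;> fin_cases j <;> simp

/-- The linear relations among the coordinates of an element of R. -/
theorem Rcond.relations {σ : M2 →ₗ[ℂ] V2} (hσ : Rcond σ) :
    σ (single 1 1 1) 0 = -σ (single 0 0 1) 0 ∧ σ (single 1 1 1) 1 = -σ (single 0 0 1) 1 ∧
      σ (single 0 1 1) 0 = σ (single 0 0 1) 1 ∧ σ (single 1 0 1) 1 = -σ (single 0 0 1) 0 := by
  have h1 : σ 1 = 0 := by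
    have h := hσ 1 1
    have hs : msharp 1 = 1 := by
      simp [msharp, two_smul]
    simpa [hs] using h
  rw [map_eq_sum_single] at h1
  have h10 := congrFun h1 0
  have h11 := congrFun h1 1
  have h01 := congrFun (hσ (single 0 0 1) (single 0 1 1)) 0
  have h10' := congrFun (hσ (single 1 1 1) (single 1 0 1)) 1
  simp [msharp, trace] at h10 h11 h01 h10'
  refine ⟨?_, ?_, ?_, ?_⟩
  · linear_combination h10
  · linear_combination h11
  · linear_combination h01
  · linear_combination h10' + h10

/-- the three identities satisfied by σ ∈ R and its transpose σ†, where σ† is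
the unique linear map valued in trace-zero matrices with tr(Y·σ†(v*)) = −2·v*(σ(Y)) for
trace-zero Y. -/
theorem sigma_dagger_identities (σ : M2 →ₗ[ℂ] V2) (hσ : Rcond σ)
    (σd : Dual2 →ₗ[ℂ] M2)
    (hd0 : ∀ vs : Dual2, (σd vs).trace = 0)
    (hdd : ∀ (vs : Dual2) (Y : M2), Y.trace = 0 → (Y * σd vs).trace = -2 * vs (σ Y)) :
    -- (i)  w*(σ(u⊗v*)) = v*(σ(u⊗w*))
    (∀ (u : V2) (vs ws : Dual2), ws (σ (rankOne u vs)) = vs (σ (rankOne u ws))) ∧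
    -- (ii)  σ†(v*)(u) = −2·σ(u⊗v*)
    (∀ (u : V2) (vs : Dual2), σd vs *ᵥ u = (-2 : ℂ) • σ (rankOne u vs)) ∧
    -- (iii)  σ†(v*∘X⁰) = σ†(v*)·X + 2·σ(X)⊗v*
    (∀ (X : M2) (vs : Dual2),
      σd (vs ∘ₗ Matrix.mulVecLin (msharp X)) = σd vs * X + (2 : ℂ) • rankOne (σ X) vs) := by
  obtain ⟨r1, r2, r3, r4⟩ := hσ.relations
  have hD (vs : Dual2) : σd vs 0 0 = -2 * vs (σ (single 0 0 1)) ∧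
      σd vs 0 1 = -2 * vs (σ (single 1 0 1)) ∧ σd vs 1 0 = -2 * vs (σ (single 0 1 1)) ∧
      σd vs 1 1 = 2 * vs (σ (single 0 0 1)) := by
    have h0 := hd0 vs
    have ha := hdd vs (single 0 1 1) (by simp [trace])
    have hb := hdd vs (single 1 0 1) (by simp [trace])
    have hc := hdd vs (single 0 0 1 - single 1 1 1) (by simp [trace, single_apply])
    have hs : σ (single 1 1 1) = -σ (single 0 0 1) := by
      ext i
      fin_cases i
      · exact r1
      · exact r2
    rw [map_sub, hs, map_sub, map_neg] at hc
    simp [trace, Matrix.mul_apply, Fin.sum_univ_two, single_apply] at h0 ha hb hc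
    refine ⟨?_, ?_, ?_, ?_⟩
    · linear_combination (h0 + hc) / 2
    · linear_combination hb
    · linear_combination ha
    · linear_combination (h0 - hc) / 2
  refine ⟨fun u vs ws => ?_, fun u vs => ?_, fun X vs => ?_⟩
  · rw [dual_apply_fin_two ws, dual_apply_fin_two vs, map_eq_sum_single σ (rankOne u vs),
      map_eq_sum_single σ (rankOne u ws)]
    simp only [rankOne, vecMulVec_apply, Pi.add_apply, Pi.smul_apply, smul_eq_mul, r1, r2, r3, r4]
    ring
  · obtain ⟨d1, d2, d3, d4⟩ := hD vs
    rw [map_eq_sum_single σ (rankOne u vs)]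
    ext i
    fin_cases i <;>
    · simp only [rankOne, vecMulVec_apply, Pi.add_apply, Pi.smul_apply, smul_eq_mul, mulVec,
        dotProduct, Fin.sum_univ_two, Fin.zero_eta, Fin.mk_one, d1, d2, d3, d4,
        dual_apply_fin_two vs (σ _), r1, r2, r3, r4]
      ring
  · rw [map_eq_sum_single σ X]
    ext i j
    fin_cases i <;> fin_cases j <;>
    · simp only [rankOne, vecMulVec_apply, Matrix.add_apply, Matrix.smul_apply, Matrix.mul_apply,
        Pi.add_apply, Pi.smul_apply, smul_eq_mul, Fin.sum_univ_two, Fin.zero_eta, Fin.mk_one, hD,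
        LinearMap.comp_apply, mulVecLin_apply, dual_apply_fin_two vs (σ _),
        dual_apply_fin_two vs (_ *ᵥ _)]
      simp only [mulVec, dotProduct, Fin.sum_univ_two, msharp, Matrix.sub_apply, Matrix.smul_apply,
        smul_eq_mul, trace_fin_two, one_fin_two, of_apply, cons_val', cons_val_zero, cons_val_one,
        cons_val_fin_one, r1, r2, r3, r4]
      ring

end
end

section
/- Let W = ℂ⁶. For every ω ∈ Λ²W with ω∧ω∧ω = 0 in Λ⁶W and every linear form h ∈ W*, there exist vectors a,b,c,d ∈ W and linear forms k,l ∈ W* such that ω = a∧b + c∧d, h = k + l, k(a) = k(b) = 0 and l(c) = l(d) = 0. (This is the statement that the secant variety of the sextonionic projective plane SP² ⊂ P(Λ²W ⊕ W*) is the determinantal cubic hypersurface, the cone {ω∧ω∧ω = 0} over the determinantal cubic of P(Λ²W).) -/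
noncomputable section

/-- W = ℂ⁶. -/
abbrev W6 : Type := Fin 6 → ℂ

/-- The subspace Λ²W of the exterior algebra of W. -/
def Lambda2 : Submodule ℂ (ExteriorAlgebra ℂ W6) :=
  LinearMap.range (ExteriorAlgebra.ι ℂ : W6 →ₗ[ℂ] ExteriorAlgebra ℂ W6) ^ 2

section BivectorNormalForm

open ExteriorAlgebra

variable {K V : Type*} [Field K] [AddCommGroup V] [Module K V]

theorem LinearIndependent.exists_dual_apply_eq {ι : Type*} {v : ι → V}
    (hv : LinearIndependent K v) (g : ι → K) : ∃ f : Module.Dual K V, ∀ i, f (v i) = g i := by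
  obtain ⟨f, hf⟩ := LinearMap.exists_extend (Finsupp.linearCombination K g ∘ₗ hv.repr)
  refine ⟨f, fun i => ?_⟩
  have h := LinearMap.congr_fun hf ⟨v i, Submodule.subset_span ⟨i, rfl⟩⟩
  rw [LinearMap.comp_apply, LinearMap.comp_apply, hv.repr_eq_single i _ rfl] at h
  simpa using h

theorem LinearIndependent.ιMulti_ne_zero {n : ℕ} {v : Fin n → V} (hv : LinearIndependent K v) :
    ιMulti K n v ≠ 0 := by
  choose f hf using fun i : Fin n => hv.exists_dual_apply_eq (Pi.single i 1)
  intro h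
  have h0 : exteriorPower.ιMulti K n v = 0 := Subtype.ext h
  have h1 := exteriorPower.pairingDual_ιMulti_ιMulti f v
  have h2 : Matrix.of (fun i j => f j (v i)) = (1 : Matrix (Fin n) (Fin n) K) := by
    ext i j
    simp [hf, Matrix.one_apply, Pi.single_apply]
  rw [h0, h2] at h1
  simp at h1

theorem ExteriorAlgebra.ι_mul_ι_swap (x y : V) : ι K x * ι K y = -(ι K y * ι K x) :=
  eq_neg_of_add_eq_zero_left (ι_add_mul_swap x y)

theorem ExteriorAlgebra.commute_ι_mul_ι (x y z w : V) :
    Commute (ι K x * ι K y) (ι K z * ι K w) := by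
  have key (u : V) : Commute (ι K x * ι K y) (ι K u) := by
    rw [Commute, SemiconjBy, mul_assoc, ι_mul_ι_swap y u, mul_neg, ← mul_assoc, ι_mul_ι_swap x u,
      neg_mul, neg_neg, mul_assoc]
  exact (key z).mul_right (key w)

theorem ExteriorAlgebra.ι_mul_ι_mul_self (x y : V) : ι K x * ι K y * (ι K x * ι K y) = 0 := by
  rw [mul_assoc, ← mul_assoc (ι K y), ι_mul_ι_swap y x, neg_mul, mul_assoc, ι_sq_zero]
  simp

theorem add_add_cube_of_mul_self_eq_zero {R : Type*} [Ring R] {x y z : R} (hxy : Commute x y)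
    (hxz : Commute x z) (hyz : Commute y z) (hx : x * x = 0) (hy : y * y = 0) (hz : z * z = 0) :
    (x + y + z) * (x + y + z) * (x + y + z) = 6 * (x * y * z) := by
  have hx' (w : R) : x * (x * w) = 0 := by rw [← mul_assoc, hx, zero_mul]
  have hy' (w : R) : y * (y * w) = 0 := by rw [← mul_assoc, hy, zero_mul]
  simp only [add_mul, mul_add, mul_assoc, hx, hy, hz, hx', hy', hxy.symm.eq, hxz.symm.eq,
    hyz.symm.eq, hxy.symm.left_comm, mul_zero]
  noncomm_ring

/-- A sum of `n + 1` decomposable bivectors whose factors satisfy a linear relation involving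
a first factor is a sum of `n` decomposable bivectors. -/
theorem ExteriorAlgebra.exists_sum_ι_mul_ι_of_relation {n : ℕ} (a b : Fin (n + 1) → V)
    (x y : Fin (n + 1) → K) (hrel : ∑ j, x j • a j + ∑ j, y j • b j = 0)
    (i : Fin (n + 1)) (hi : x i ≠ 0) :
    ∃ a' b' : Fin n → V, ∑ j, ι K (a j) * ι K (b j) = ∑ j, ι K (a' j) * ι K (b' j) := by
  have ha : a i = -(x i)⁻¹ • (∑ j, x (i.succAbove j) • a (i.succAbove j) +
      (y i • b i + ∑ j, y (i.succAbove j) • b (i.succAbove j))) := by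
    rw [Fin.sum_univ_succAbove _ i, Fin.sum_univ_succAbove _ i, add_assoc] at hrel
    rw [neg_smul, ← smul_neg, ← eq_neg_of_add_eq_zero_left hrel, inv_smul_smul₀ hi]
  refine ⟨fun j => a (i.succAbove j) + ((x i)⁻¹ * y (i.succAbove j)) • b i,
    fun j => b (i.succAbove j) - ((x i)⁻¹ * x (i.succAbove j)) • b i, ?_⟩
  have hab : ι K (a i) * ι K (b i) =
      ∑ j, (-((x i)⁻¹ * x (i.succAbove j)) • (ι K (a (i.succAbove j)) * ι K (b i)) +
        ((x i)⁻¹ * y (i.succAbove j)) • (ι K (b i) * ι K (b (i.succAbove j)))) := by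
    conv_lhs => rw [ha]
    simp only [map_smul, map_add, map_neg, map_sum, smul_mul_assoc, add_mul, Finset.sum_mul,
      ι_sq_zero, ι_mul_ι_swap (b (i.succAbove _)) (b i), smul_zero, neg_zero, zero_add, smul_add,
      Finset.smul_sum, Finset.sum_add_distrib, smul_neg, neg_smul, neg_mul, neg_neg, smul_smul,
      Finset.sum_neg_distrib]
  rw [Fin.sum_univ_succAbove _ i, hab, ← Finset.sum_add_distrib]
  refine Finset.sum_congr rfl fun j _ => ?_
  simp only [map_add, map_sub, map_smul, add_mul, mul_sub, smul_mul_assoc, mul_smul_comm,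
    ι_sq_zero, smul_zero, add_zero, neg_smul]
  abel

theorem ExteriorAlgebra.exists_sum_ι_mul_ι_of_not_linearIndependent {n : ℕ}
    (a b : Fin (n + 1) → V) (hab : ¬LinearIndependent K (Sum.elim a b)) :
    ∃ a' b' : Fin n → V, ∑ j, ι K (a j) * ι K (b j) = ∑ j, ι K (a' j) * ι K (b' j) := by
  obtain ⟨g, hg, i, hi⟩ := Fintype.not_linearIndependent_iff.mp hab
  simp only [Fintype.sum_sum_type, Sum.elim_inl, Sum.elim_inr] at hg
  obtain i | i := i
  · exact exists_sum_ι_mul_ι_of_relation a b _ _ hg i hi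
  · obtain ⟨a', b', h⟩ := exists_sum_ι_mul_ι_of_relation b (-a) (fun j => g (.inr j))
      (fun j => -g (.inl j)) (by simpa [add_comm] using hg) i hi
    refine ⟨a', b', h ▸ Finset.sum_congr rfl fun j _ => ?_⟩
    rw [ι_mul_ι_swap, Pi.neg_apply, map_neg, mul_neg]

theorem ExteriorAlgebra.exists_eq_sum_ι_mul_ι {ω : ExteriorAlgebra K V}
    (hω : ω ∈ LinearMap.range (ι K : V →ₗ[K] ExteriorAlgebra K V) ^ 2) :
    ∃ (n : ℕ) (a b : Fin n → V), ω = ∑ j, ι K (a j) * ι K (b j) := by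
  rw [pow_two] at hω
  induction hω using Submodule.mul_induction_on' with
  | mem_mul_mem x hx y hy =>
    obtain ⟨u, rfl⟩ := hx
    obtain ⟨v, rfl⟩ := hy
    exact ⟨1, fun _ => u, fun _ => v, by simp⟩
  | add x _ y _ hx hy =>
    obtain ⟨n, a, b, rfl⟩ := hx
    obtain ⟨m, c, d, rfl⟩ := hy
    exact ⟨n + m, Fin.append a c, Fin.append b d, by simp [Fin.sum_univ_add]⟩

/-- Every bivector is a sum of decomposable bivectors with linearly independent factors. -/
theorem ExteriorAlgebra.exists_linearIndependent_eq_sum_ι_mul_ι {ω : ExteriorAlgebra K V}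
    (hω : ω ∈ LinearMap.range (ι K : V →ₗ[K] ExteriorAlgebra K V) ^ 2) :
    ∃ (n : ℕ) (a b : Fin n → V), LinearIndependent K (Sum.elim a b) ∧
      ω = ∑ j, ι K (a j) * ι K (b j) := by
  obtain ⟨n, a, b, h⟩ := exists_eq_sum_ι_mul_ι hω
  induction n with
  | zero => exact ⟨0, a, b, linearIndependent_empty_type, h⟩
  | succ n ih =>
    by_cases hab : LinearIndependent K (Sum.elim a b)
    · exact ⟨n + 1, a, b, hab, h⟩
    · obtain ⟨a', b', h'⟩ := exists_sum_ι_mul_ι_of_not_linearIndependent a b hab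
      exact ih a' b' (h.trans h')

theorem ExteriorAlgebra.sum_ι_mul_ι_cube_ne_zero [CharZero K] {a b : Fin 3 → V}
    (hab : LinearIndependent K (Sum.elim a b)) :
    (∑ j, ι K (a j) * ι K (b j)) * (∑ j, ι K (a j) * ι K (b j)) *
      (∑ j, ι K (a j) * ι K (b j)) ≠ 0 := by
  have hli := hab.comp ![.inl 0, .inr 0, .inl 1, .inr 1, .inl 2, .inr 2] (by decide)
  have hne := hli.ιMulti_ne_zero
  have h6 : (6 : ExteriorAlgebra K V) = algebraMap K _ 6 := (map_ofNat _ 6).symm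
  rw [Fin.sum_univ_three, add_add_cube_of_mul_self_eq_zero (commute_ι_mul_ι _ _ _ _)
    (commute_ι_mul_ι _ _ _ _) (commute_ι_mul_ι _ _ _ _) (ι_mul_ι_mul_self _ _)
    (ι_mul_ι_mul_self _ _) (ι_mul_ι_mul_self _ _), h6, ← Algebra.smul_def]
  refine smul_ne_zero (by norm_num) ?_
  simpa [ιMulti_apply, List.ofFn_succ, Matrix.vecTail, Function.comp_def, mul_assoc] using hne

end BivectorNormalForm

/-- for every ω ∈ Λ²W with ω∧ω∧ω = 0 and every linear form h ∈ W*, one can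
write ω = a∧b + c∧d and h = k + l with k vanishing on a,b and l vanishing on c,d. (The
secant variety of the sextonionic projective plane SP² ⊂ P(Λ²W ⊕ W*) is the cone over the
determinantal cubic.) -/
theorem secant_variety_of_sextonionic_plane_is_determinantal_cubic
    (ω : ExteriorAlgebra ℂ W6) (hω : ω ∈ Lambda2) (hcube : ω * ω * ω = 0)
    (h : Module.Dual ℂ W6) :
    ∃ (a b c d : W6) (k l : Module.Dual ℂ W6),
      ω = ExteriorAlgebra.ι ℂ a * ExteriorAlgebra.ι ℂ b
          + ExteriorAlgebra.ι ℂ c * ExteriorAlgebra.ι ℂ d ∧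
      h = k + l ∧ k a = 0 ∧ k b = 0 ∧ l c = 0 ∧ l d = 0 := by
  obtain ⟨n, a, b, hab, rfl⟩ := ExteriorAlgebra.exists_linearIndependent_eq_sum_ι_mul_ι hω
  have hn : n + n ≤ 6 := by simpa using hab.fintype_card_le_finrank
  obtain rfl | rfl | rfl | rfl : n = 0 ∨ n = 1 ∨ n = 2 ∨ n = 3 := by omega
  · exact ⟨0, 0, 0, 0, 0, h, by simp⟩
  · exact ⟨a 0, b 0, 0, 0, 0, h, by simp⟩
  · obtain ⟨k, hk⟩ := hab.exists_dual_apply_eq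
      (Sum.elim ![0, h (a 1)] ![0, h (b 1)])
    refine ⟨a 0, b 0, a 1, b 1, k, h - k, Fin.sum_univ_two _, by simp, ?_, ?_, ?_, ?_⟩
    · simpa using hk (.inl 0)
    · simpa using hk (.inr 0)
    · simpa [sub_eq_zero, eq_comm (a := h _)] using hk (.inl 1)
    · simpa [sub_eq_zero, eq_comm (a := h _)] using hk (.inr 1)
  · exact absurd hcube (ExteriorAlgebra.sum_ι_mul_ι_cube_ne_zero hab)

end
end
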